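/- Analytic core of the advantage-distillation security condition: let h₂ denote the base-2 binary entropy h₂(x) = −x·log₂ x − (1−x)·log₂(1−x) (with h₂(0) = 0). For every ε ∈ (0,1/2) and every α with ε/(1−ε) < α ≤ 1, setting δ_k := ε^k / (ε^k + (1−ε)^k), the sequence k ↦ ( α^k/ln 4 − δ_k − (1+δ_k)·h₂(δ_k/(1+δ_k)) ) / h₂(δ_k) tends to +∞ as k → ∞. -/

import Mathlib

open Real Filter

/-- The base-2 binary entropy function `h₂(x) = -x·log₂ x - (1-x)·log₂(1-x)`. -/
noncomputable def binEntropy2 (x : ℝ) : ℝ := -x * logb 2 x - (1 - x) * logb 2 (1 - x)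

theorem binEntropy2_eq_binEntropy_div_log_two (x : ℝ) : binEntropy2 x = binEntropy x / log 2 := by
  simp only [binEntropy2, binEntropy, logb, Real.log_inv]
  ring

theorem mul_neg_log_le_binEntropy {x : ℝ} (hx₀ : 0 < x) (hx₁ : x < 1) :
    x * -log x ≤ binEntropy x := by
  have h : log (1 - x) ≤ 0 := Real.log_nonpos (by linarith) (by linarith)
  rw [binEntropy, Real.log_inv, Real.log_inv]
  nlinarith

theorem binEntropy_le_mul_one_sub_log {x : ℝ} (hx₁ : x < 1) :
    binEntropy x ≤ x * (1 - log x) := by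
  have hpos : 0 < 1 - x := by linarith
  have h := mul_le_mul_of_nonneg_left
    (Real.log_le_sub_one_of_pos (inv_pos.mpr hpos)) hpos.le
  rw [mul_sub, mul_inv_cancel₀ hpos.ne'] at h
  rw [binEntropy, Real.log_inv x]
  linarith

theorem one_add_mul_binEntropy_div_one_add {x : ℝ} (hx : 0 < x) :
    (1 + x) * binEntropy (x / (1 + x)) = (1 + x) * log (1 + x) - x * log x := by
  have hpos : 0 < 1 + x := by linarith
  have h : 1 - x / (1 + x) = (1 + x)⁻¹ := by field_simp; ring
  rw [binEntropy, h, Real.log_inv, inv_inv, Real.log_div hx.ne' hpos.ne']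
  field_simp
  ring

/-- The entropy ratio is at least `a / (2 H(δ))` up to an additive constant, where `H` is the
natural-logarithm binary entropy. -/
theorem div_binEntropy_sub_le_entropy_ratio (a : ℝ) {δ : ℝ} (hδ₀ : 0 < δ) (hδ₁ : δ ≤ 1 / 2) :
    a / (2 * binEntropy δ) - 6 ≤
      (a / log 4 - δ - (1 + δ) * binEntropy2 (δ / (1 + δ))) / binEntropy2 δ := by
  have hl : (1 / 2 : ℝ) < log 2 := by linarith [Real.log_two_gt_d9]
  have hl' : log 2 < 1 := by linarith [Real.log_two_lt_d9]
  have hl4 : log 4 = 2 * log 2 := by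
    rw [show (4 : ℝ) = 2 ^ 2 by norm_num, Real.log_pow]; norm_num
  have hH : 0 < binEntropy δ := binEntropy_pos hδ₀ (by linarith)
  have hlow := mul_neg_log_le_binEntropy hδ₀ (by linarith)
  have hlogδ : log δ ≤ -log 2 := by
    rw [← Real.log_inv]
    exact Real.log_le_log hδ₀ (by linarith)
  have hδH : δ * (1 / 2) ≤ binEntropy δ :=
    (mul_le_mul_of_nonneg_left (by linarith) hδ₀.le).trans hlow
  have hlog : log (1 + δ) ≤ δ := by
    linarith [Real.log_le_sub_one_of_pos (show 0 < 1 + δ by linarith)]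
  have hA := one_add_mul_binEntropy_div_one_add hδ₀
  have hbound : δ * log 2 + (1 + δ) * binEntropy (δ / (1 + δ)) ≤ 6 * binEntropy δ := by
    rw [hA]
    nlinarith
  have hratio : (a / log 4 - δ - (1 + δ) * binEntropy2 (δ / (1 + δ))) / binEntropy2 δ =
      a / (2 * binEntropy δ) -
        (δ * log 2 + (1 + δ) * binEntropy (δ / (1 + δ))) / binEntropy δ := by
    have hl0 : log 2 ≠ 0 := by linarith
    rw [binEntropy2_eq_binEntropy_div_log_two, binEntropy2_eq_binEntropy_div_log_two, hl4]
    generalize binEntropy (δ / (1 + δ)) = B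
    field_simp
    ring
  rw [hratio]
  exact sub_le_sub_left ((div_le_iff₀ hH).mpr hbound) _

theorem tendsto_pow_div_linear_atTop {s : ℝ} (hs : 1 < s) {b c : ℝ} (hb : 0 ≤ b) (hc : 0 < c) :
    Tendsto (fun k : ℕ => s ^ k / (k * b + c)) atTop atTop := by
  have hs0 : 0 < s := by linarith
  have hr : s⁻¹ < 1 := inv_lt_one_of_one_lt₀ hs
  have h1 := (tendsto_self_mul_const_pow_of_lt_one (inv_nonneg.mpr hs0.le) hr).const_mul b
  have h2 := (tendsto_pow_atTop_nhds_zero_of_lt_one (inv_nonneg.mpr hs0.le) hr).const_mul c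
  have h := h1.add h2
  simp only [mul_zero, add_zero] at h
  have h' : Tendsto (fun k : ℕ => b * (k * s⁻¹ ^ k) + c * s⁻¹ ^ k) atTop
      (nhdsWithin 0 (Set.Ioi 0)) :=
    tendsto_nhdsWithin_iff.mpr ⟨h, Eventually.of_forall fun k => by
      simp only [Set.mem_Ioi]; positivity⟩
  refine h'.inv_tendsto_nhdsGT_zero.congr fun k => ?_
  have : 0 < k * b + c := by positivity
  have e : b * (k * s⁻¹ ^ k) + c * s⁻¹ ^ k = (k * b + c) / s ^ k := by
    rw [inv_pow]; ring
  rw [Pi.inv_apply, e, inv_div]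

/-- Analytic core of the advantage-distillation security condition: the paper's lower
bound on the entropy ratio for blocks of size `k` diverges whenever
`ε/(1-ε) < α ≤ 1`. -/
theorem stmt_12 (ε α : ℝ) (hε : ε ∈ Set.Ioo (0 : ℝ) (1 / 2))
    (hα₁ : ε / (1 - ε) < α) (hα₂ : α ≤ 1) :
    Tendsto (fun k : ℕ =>
        (α ^ k / Real.log 4 - ε ^ k / (ε ^ k + (1 - ε) ^ k)
            - (1 + ε ^ k / (ε ^ k + (1 - ε) ^ k)) *
              binEntropy2 ((ε ^ k / (ε ^ k + (1 - ε) ^ k)) /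
                (1 + ε ^ k / (ε ^ k + (1 - ε) ^ k))))
          / binEntropy2 (ε ^ k / (ε ^ k + (1 - ε) ^ k)))
      atTop atTop := by
  obtain ⟨hε₀, hε₁⟩ := hε
  have hε' : 0 < 1 - ε := by linarith
  set r := ε / (1 - ε) with hr
  have hr₀ : 0 < r := div_pos hε₀ hε'
  have hr₁ : r < 1 := (div_lt_one hε').mpr (by linarith)
  have hα₀ : 0 < α := hr₀.trans hα₁
  have hlogr : log r < 0 := Real.log_neg hr₀ hr₁
  have hlim := (tendsto_pow_div_linear_atTop ((one_lt_div hr₀).mpr hα₁)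
    (b := 2 * -log r) (c := 4) (by linarith) (by norm_num))
  refine tendsto_atTop_mono (fun k => ?_) (tendsto_atTop_add_const_right _ (-6) hlim)
  have hx₀ : 0 < r ^ k := pow_pos hr₀ k
  have hx₁ : r ^ k ≤ 1 := pow_le_one₀ hr₀.le hr₁.le
  have hδ : ε ^ k / (ε ^ k + (1 - ε) ^ k) = r ^ k / (1 + r ^ k) := by
    have h₁ := pow_pos hε₀ k
    have h₂ := pow_pos hε' k
    rw [hr, div_pow]
    field_simp
    ring
  rw [hδ]
  have hδ₀ : 0 < r ^ k / (1 + r ^ k) := by positivity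
  have hδ₁ : r ^ k / (1 + r ^ k) ≤ 1 / 2 := by
    rw [div_le_div_iff₀ (by positivity) (by norm_num)]
    linarith
  have hδx : r ^ k / (1 + r ^ k) ≤ r ^ k := div_le_self hx₀.le (by linarith)
  have hlogδ : k * log r - 1 ≤ log (r ^ k / (1 + r ^ k)) := by
    rw [Real.log_div hx₀.ne' (by positivity), Real.log_pow]
    linarith [Real.log_le_sub_one_of_pos (show 0 < 1 + r ^ k by positivity)]
  refine le_trans ?_ (div_binEntropy_sub_le_entropy_ratio (α ^ k) hδ₀ hδ₁)
  have hH : binEntropy (r ^ k / (1 + r ^ k)) ≤ r ^ k * (k * -log r + 2) := by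
    have hk : 0 ≤ k * -log r := mul_nonneg k.cast_nonneg (by linarith)
    refine (binEntropy_le_mul_one_sub_log (by linarith)).trans ?_
    exact (mul_le_mul_of_nonneg_left (by linarith) hδ₀.le).trans
      (mul_le_mul_of_nonneg_right hδx (by linarith))
  have hHpos := binEntropy_pos hδ₀ (by linarith)
  rw [← sub_eq_add_neg, div_pow, div_div]
  refine sub_le_sub_right (div_le_div_of_nonneg_left (by positivity) (by positivity) ?_) 6
  linarith
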